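/- arXiv:2411.13969 — 2 statements merged into one kernel-verified Lean document; each statement's English description precedes it below -/
import Mathlib

section
/- Let V ∈ C(X×Y) be nonnegative, κ > 0, τ > 0, ν a probability measure on Y, and μ a probability measure on X absolutely continuous with respect to Lebesgue measure. Let ρ⁰ ∈ Γ(μ,ν) with E(ρ⁰) := ∫ V dρ⁰ + κ H(ρ⁰|ν) < ∞, and let (ρⁿ)_{n≥0} be a sequence in Γ(μ,ν) such that for each n ≥ 1, ρⁿ minimizes ρ ↦ (1/2τ) W_F(ρ,ρ^{n−1})² + ∫ V dρ + κ H(ρ|ν) over Γ(μ,ν). Then for all m, n ≥ 0: W(ρ^m, ρ^n) ≤ W_F(ρ^m, ρ^n) ≤ sqrt(2 E(ρ⁰)) · sqrt(τ |m−n|), where W is the 2-Wasserstein distance on probability measures on X×Y. -/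
open MeasureTheory ProbabilityTheory Filter Set
open scoped ENNReal Topology

noncomputable section

abbrev Euc (n : ℕ) : Type := EuclideanSpace ℝ (Fin n)

/-- The set of couplings (transport plans) between two measures. -/
def Couplings {α β : Type*} [MeasurableSpace α] [MeasurableSpace β]
    (μ : Measure α) (ν : Measure β) : Set (Measure (α × β)) :=
  {γ | IsProbabilityMeasure γ ∧ γ.map Prod.fst = μ ∧ γ.map Prod.snd = ν}

/-- Optimal transport cost between two measures for cost `c`. -/
def transportCost {α β : Type*} [MeasurableSpace α] [MeasurableSpace β]
    (c : α → β → ℝ≥0∞) (μ : Measure α) (ν : Measure β) : ℝ≥0∞ :=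
  ⨅ γ ∈ Couplings μ ν, ∫⁻ p, c p.1 p.2 ∂γ

/-- Squared 2-Wasserstein distance. -/
noncomputable def W2sq {α : Type*} [MeasurableSpace α] [PseudoEMetricSpace α]
    (μ ν : Measure α) : ℝ≥0∞ :=
  transportCost (fun a b => edist a b ^ 2) μ ν

/-- `K` is the disintegration of `ρ` with respect to its second marginal `ν`. -/
def IsDisint {α β : Type*} [MeasurableSpace α] [MeasurableSpace β]
    (ν : Measure β) (ρ : Measure (α × β)) (K : Kernel β α) : Prop :=
  IsMarkovKernel K ∧
    ∀ s : Set α, ∀ t : Set β, MeasurableSet s → MeasurableSet t →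
      ρ (s ×ˢ t) = ∫⁻ y in t, K y s ∂ν

/-- Squared fibered Wasserstein distance `W_F(ρ₁,ρ₂)² = ∫_Y W(ρ_{1,y},ρ_{2,y})² dν(y)`,
expressed through the (a.e.-unique) disintegrations of `ρ₁, ρ₂` w.r.t. `ν`. -/
noncomputable def WFsq {α β : Type*} [MeasurableSpace α] [PseudoEMetricSpace α]
    [MeasurableSpace β] (ν : Measure β) (ρ₁ ρ₂ : Measure (α × β)) : ℝ≥0∞ :=
  ⨅ (K₁ : Kernel β α) (K₂ : Kernel β α) (_ : IsDisint ν ρ₁ K₁) (_ : IsDisint ν ρ₂ K₂),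
    ∫⁻ y, W2sq (K₁ y) (K₂ y) ∂ν

/-- The integrand `s ↦ s log s − s + 1` of the entropy. -/
def entT (s : ℝ) : ℝ := s * Real.log s - s + 1

open scoped Classical in
/-- Weighted negative entropy of `ρ` relative to the reference measure `π`. -/
noncomputable def entropyH {α : Type*} [MeasurableSpace α] (π ρ : Measure α) : ℝ≥0∞ :=
  if ρ ≪ π then ∫⁻ p, ENNReal.ofReal (entT ((ρ.rnDeriv π p).toReal)) ∂π else ⊤

/-- The reference measure `𝓛|X ⊗ ν` on `X × Y`. -/
noncomputable def Lref {d d' : ℕ} (X : Set (Euc d)) (ν : Measure (Euc d')) :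
    Measure (Euc d × Euc d') :=
  (MeasureTheory.volume.restrict X).prod ν

/-- The minimizing movement functional
`E_τ(ρ | ρ̄) = (1/2τ) W_F(ρ, ρ̄)² + ∫ V dρ + κ H(ρ|ν)`. -/
noncomputable def JKOFun {d d' : ℕ} (X : Set (Euc d)) (ν : Measure (Euc d'))
    (V : Euc d × Euc d' → ℝ) (κ τ : ℝ) (ρbar ρ : Measure (Euc d × Euc d')) : ℝ≥0∞ :=
  ENNReal.ofReal (1 / (2 * τ)) * WFsq ν ρ ρbar
    + (∫⁻ p, ENNReal.ofReal (V p) ∂ρ) + ENNReal.ofReal κ * entropyH (Lref X ν) ρ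

/-- The entropic optimal transport energy `E(ρ) = ∫ V dρ + κ H(ρ|ν)`. -/
noncomputable def energyE {d d' : ℕ} (X : Set (Euc d)) (ν : Measure (Euc d'))
    (V : Euc d × Euc d' → ℝ) (κ : ℝ) (ρ : Measure (Euc d × Euc d')) : ℝ≥0∞ :=
  (∫⁻ p, ENNReal.ofReal (V p) ∂ρ) + ENNReal.ofReal κ * entropyH (Lref X ν) ρ

/-- Squared Euclidean distance on the product `X × Y ⊂ ℝ^d × ℝ^{d'}`. -/
noncomputable def prodCostSq {d d' : ℕ} (p q : Euc d × Euc d') : ℝ≥0∞ :=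
  edist p.1 q.1 ^ 2 + edist p.2 q.2 ^ 2

open scoped Classical in
/-- A nonnegative matrix `a`, seen as a density with respect to the product weights `p ⊗ q`,
completed by a rank-one term so that its marginals become exactly `p` and `q`. -/
def roundMatrix {I : Type*} [Fintype I] (a : I → I → ℝ≥0∞) (p q : I → ℝ≥0∞) (i j : I) : ℝ≥0∞ :=
  if (∀ i, ∑ j, a i j * q j ≤ 1) ∧ (∀ j, ∑ i, a i j * p i ≤ 1) ∧
      ∑ i, ∑ j, a i j * p i * q j < 1 then
    a i j + (1 - ∑ j', a i j' * q j') * (1 - ∑ i', a i' j * p i') /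
      (1 - ∑ i', ∑ j', a i' j' * p i' * q j')
  else 1

section RoundMatrix

variable {I : Type*} [Fintype I]

theorem roundMatrix_swap (a : I → I → ℝ≥0∞) (p q : I → ℝ≥0∞) (i j : I) :
    roundMatrix a p q i j = roundMatrix (fun i j => a j i) q p j i := by
  have h : ∑ i, ∑ j, a i j * p i * q j = ∑ i, ∑ j, a j i * q i * p j := by
    rw [Finset.sum_comm]
    exact Finset.sum_congr rfl fun _ _ => Finset.sum_congr rfl fun _ _ => by ring
  unfold roundMatrix
  rw [h]
  congr 1
  · rw [eq_iff_iff]; tauto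
  · rw [mul_comm (1 - _) (1 - _)]

theorem sum_one_sub_mul {c q : I → ℝ≥0∞} (hq : ∑ j, q j = 1) (hc : ∀ j, c j ≤ 1) :
    ∑ j, (1 - c j) * q j = 1 - ∑ j, c j * q j := by
  have h : ∑ j, (1 - c j) * q j + ∑ j, c j * q j = 1 := by
    rw [← Finset.sum_add_distrib]
    refine Eq.trans ?_ hq
    refine Finset.sum_congr rfl fun j _ => ?_
    rw [← add_mul, tsub_add_cancel_of_le (hc j), one_mul]
  refine ENNReal.eq_sub_of_add_eq (ne_top_of_le_ne_top ENNReal.one_ne_top ?_) h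
  exact h ▸ le_add_self

theorem sum_roundMatrix_mul (a : I → I → ℝ≥0∞) {p q : I → ℝ≥0∞}
    (hq : ∑ j, q j = 1) (i : I) : ∑ j, roundMatrix a p q i j * q j = 1 := by
  unfold roundMatrix
  split_ifs with h
  · obtain ⟨h1, h2, h3⟩ := h
    have hs : ∑ j, (1 - ∑ i', a i' j * p i') * q j = 1 - ∑ i', ∑ j', a i' j' * p i' * q j' := by
      rw [sum_one_sub_mul hq h2, Finset.sum_comm]
      simp_rw [Finset.sum_mul]
    have hs0 : 1 - ∑ i', ∑ j', a i' j' * p i' * q j' ≠ 0 := (tsub_pos_of_lt h3).ne'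
    have hst : 1 - ∑ i', ∑ j', a i' j' * p i' * q j' ≠ ⊤ := by finiteness
    simp_rw [add_mul, Finset.sum_add_distrib]
    generalize 1 - ∑ i', ∑ j', a i' j' * p i' * q j' = s at *
    have : ∑ j, (1 - ∑ j', a i j' * q j') * (1 - ∑ i', a i' j * p i') / s * q j
        = (1 - ∑ j', a i j' * q j') * s⁻¹ * ∑ j, (1 - ∑ i', a i' j * p i') * q j := by
      rw [Finset.mul_sum]
      exact Finset.sum_congr rfl fun j _ => by rw [div_eq_mul_inv]; ring
    rw [this, hs, mul_assoc, ENNReal.inv_mul_cancel hs0 hst, mul_one,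
      add_tsub_cancel_of_le (h1 i)]
  · simpa using hq

theorem sum_roundMatrix_mul' (a : I → I → ℝ≥0∞) {p q : I → ℝ≥0∞}
    (hp : ∑ i, p i = 1) (j : I) : ∑ i, roundMatrix a p q i j * p i = 1 := by
  simp_rw [roundMatrix_swap a p q]
  exact sum_roundMatrix_mul _ hp j

theorem measurable_roundMatrix {β : Type*} [MeasurableSpace β] (a : I → I → ℝ≥0∞)
    {p q : β → I → ℝ≥0∞} (hp : ∀ i, Measurable fun y => p y i)
    (hq : ∀ i, Measurable fun y => q y i) (i j : I) :
    Measurable fun y => roundMatrix a (p y) (q y) i j := by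
  unfold roundMatrix
  refine Measurable.ite ?_ (by fun_prop) measurable_const
  have h₁ : MeasurableSet {y | ∀ i, ∑ j, a i j * q y j ≤ 1} := by
    rw [ofPred_forall]
    exact .iInter fun i => measurableSet_le (by fun_prop) measurable_const
  have h₂ : MeasurableSet {y | ∀ j, ∑ i, a i j * p y i ≤ 1} := by
    rw [ofPred_forall]
    exact .iInter fun i => measurableSet_le (by fun_prop) measurable_const
  have h₃ : MeasurableSet {y | ∑ i, ∑ j, a i j * p y i * q y j < 1} :=
    measurableSet_lt (by fun_prop) measurable_const
  exact h₁.inter (h₂.inter h₃)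

/-- Any discrete coupling `g` of `p` and `q` is approximated by roundings of rational matrices. -/
theorem exists_rat_roundMatrix_le {p q : I → ℝ≥0∞} {g : I → I → ℝ≥0∞}
    (hgp : ∀ i, ∑ j, g i j = p i) (hgq : ∀ j, ∑ i, g i j = q j) (hp : ∑ i, p i = 1)
    (hq : ∑ j, q j = 1) {ε : ℝ≥0∞} (hε : ε ≠ 0) :
    ∃ a : I → I → ℚ, ∀ (C : ℝ≥0∞) (m : I → I → ℝ≥0∞), (∀ i j, m i j ≤ C) →
      ∑ i, ∑ j, m i j * (roundMatrix (fun i j => ((Real.toNNReal (a i j) : NNReal) : ℝ≥0∞))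
        p q i j * p i * q j) ≤ ∑ i, ∑ j, m i j * g i j + C * ε := by
  obtain ⟨θ, hθ₀, hθ₁⟩ : ∃ θ, 1 - ε < θ ∧ θ < 1 :=
    exists_between (ENNReal.sub_lt_self ENNReal.one_ne_top one_ne_zero hε)
  have hp1 : ∀ i, p i ≤ 1 := fun i => hp ▸ Finset.single_le_sum (by simp) (Finset.mem_univ i)
  have hq1 : ∀ i, q i ≤ 1 := fun i => hq ▸ Finset.single_le_sum (by simp) (Finset.mem_univ i)
  have hgip : ∀ i j, g i j ≤ p i := fun i j =>
    hgp i ▸ Finset.single_le_sum (f := g i) (by simp) (Finset.mem_univ j)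
  have hgjq : ∀ i j, g i j ≤ q j := fun i j =>
    hgq j ▸ Finset.single_le_sum (f := fun i => g i j) (by simp) (Finset.mem_univ i)
  have hpt : ∀ i, p i ≠ ⊤ := fun i => ne_top_of_le_ne_top ENNReal.one_ne_top (hp1 i)
  have hqt : ∀ i, q i ≠ ⊤ := fun i => ne_top_of_le_ne_top ENNReal.one_ne_top (hq1 i)
  have hpq : ∀ i j, p i * q j = 0 → g i j = 0 := fun i j h => by
    rcases mul_eq_zero.1 h with h | h
    · simpa [h] using hgip i j
    · simpa [h] using hgjq i j
  have hbg : ∀ i j, g i j / (p i * q j) * (p i * q j) = g i j := fun i j =>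
    ENNReal.div_mul_cancel' (hpq i j) fun h => absurd h (ENNReal.mul_ne_top (hpt i) (hqt j))
  have hex : ∀ i j, ∃ a : ℚ, (1 - ε) * (g i j / (p i * q j)) ≤ (Real.toNNReal a : NNReal) ∧
      ((Real.toNNReal a : NNReal) : ℝ≥0∞) ≤ θ * (g i j / (p i * q j)) := fun i j => by
    by_cases h0 : g i j = 0
    · exact ⟨0, by simp [h0]⟩
    have hpq0 : p i * q j ≠ 0 := fun h => h0 (hpq i j h)
    have hbt : g i j / (p i * q j) ≠ ⊤ :=
      (ENNReal.div_lt_top (ne_top_of_le_ne_top (hpt i) (hgip i j)) hpq0).ne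
    have hb0 : g i j / (p i * q j) ≠ 0 :=
      (ENNReal.div_pos h0 (ENNReal.mul_ne_top (hpt i) (hqt j))).ne'
    obtain ⟨a, -, h1, h2⟩ := ENNReal.lt_iff_exists_rat_btwn.1
      (ENNReal.mul_lt_mul_left hb0 hbt hθ₀)
    exact ⟨a, h1.le, h2.le⟩
  choose a ha₀ ha₁ using hex
  refine ⟨a, fun C m hm => ?_⟩
  set A : I → I → ℝ≥0∞ := fun i j => ((Real.toNNReal (a i j) : NNReal) : ℝ≥0∞) with hA
  have hAg : ∀ i j, A i j * p i * q j ≤ θ * g i j := fun i j => by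
    rw [mul_assoc, ← hbg i j, ← mul_assoc θ]
    exact mul_le_mul_left (ha₁ i j) _
  have hAg' : ∀ i j, (1 - ε) * g i j ≤ A i j * p i * q j := fun i j => by
    rw [mul_assoc, ← hbg i j, ← mul_assoc (1 - ε)]
    exact mul_le_mul_left (ha₀ i j) _
  have hAg1 : ∀ i j, A i j * p i * q j ≤ g i j := fun i j =>
    (hAg i j).trans (mul_le_of_le_one_left' hθ₁.le)
  have hA0 : ∀ i j, g i j = 0 → A i j = 0 := fun i j h =>
    nonpos_iff_eq_zero.1 ((ha₁ i j).trans (by simp [h]))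
  have hsg : ∑ i, ∑ j, g i j = 1 := by simp_rw [hgp, hp]
  have hrow : ∀ i, ∑ j, A i j * q j ≤ 1 := fun i => by
    by_cases h0 : p i = 0
    · have : ∀ j, A i j = 0 := fun j => hA0 i j (by simpa [h0] using hgip i j)
      simp [this]
    · rw [← ENNReal.mul_le_mul_iff_right h0 (hpt i), mul_one, Finset.mul_sum]
      calc ∑ j, p i * (A i j * q j) ≤ ∑ j, g i j :=
            Finset.sum_le_sum fun j _ => by
              rw [← mul_assoc, mul_comm (p i)]; exact hAg1 i j
        _ = p i := hgp i
  have hcol : ∀ j, ∑ i, A i j * p i ≤ 1 := fun j => by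
    by_cases h0 : q j = 0
    · have : ∀ i, A i j = 0 := fun i => hA0 i j (by simpa [h0] using hgjq i j)
      simp [this]
    · rw [← ENNReal.mul_le_mul_iff_left h0 (hqt j), one_mul, Finset.sum_mul]
      calc ∑ i, A i j * p i * q j ≤ ∑ i, g i j := Finset.sum_le_sum fun i _ => hAg1 i j
        _ = q j := hgq j
  have htot : ∑ i, ∑ j, A i j * p i * q j < 1 := by
    refine lt_of_le_of_lt (b := θ) ?_ hθ₁
    calc ∑ i, ∑ j, A i j * p i * q j ≤ ∑ i, ∑ j, θ * g i j :=
          Finset.sum_le_sum fun i _ => Finset.sum_le_sum fun j _ => hAg i j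
      _ = θ := by simp_rw [← Finset.mul_sum]; rw [hsg, mul_one]
  have htot' : 1 - ∑ i, ∑ j, A i j * p i * q j ≤ ε := by
    have : 1 - ε ≤ ∑ i, ∑ j, A i j * p i * q j := by
      calc 1 - ε = ∑ i, ∑ j, (1 - ε) * g i j := by
            simp_rw [← Finset.mul_sum]; rw [hsg, mul_one]
        _ ≤ _ := Finset.sum_le_sum fun i _ => Finset.sum_le_sum fun j _ => hAg' i j
    rw [tsub_le_iff_right] at this ⊢
    rwa [add_comm]
  have hs0 : 1 - ∑ i, ∑ j, A i j * p i * q j ≠ 0 := (tsub_pos_of_lt htot).ne'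
  have hst : 1 - ∑ i, ∑ j, A i j * p i * q j ≠ ⊤ := by finiteness
  have hr1 : ∑ i, (1 - ∑ j, A i j * q j) * p i = 1 - ∑ i, ∑ j, A i j * p i * q j := by
    rw [sum_one_sub_mul hp hrow]
    simp_rw [Finset.sum_mul]
    congr 1
    exact Finset.sum_congr rfl fun _ _ => Finset.sum_congr rfl fun _ _ => by ring
  have hr2 : ∑ j, (1 - ∑ i, A i j * p i) * q j = 1 - ∑ i, ∑ j, A i j * p i * q j := by
    rw [sum_one_sub_mul hq hcol, Finset.sum_comm]
    simp_rw [Finset.sum_mul]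
  have hR : ∀ i j, roundMatrix A p q i j = A i j + (1 - ∑ j', A i j' * q j') *
      (1 - ∑ i', A i' j * p i') / (1 - ∑ i', ∑ j', A i' j' * p i' * q j') := fun i j =>
    if_pos ⟨hrow, hcol, htot⟩
  simp_rw [hR]
  generalize 1 - ∑ i, ∑ j, A i j * p i * q j = s at *
  calc _ ≤ ∑ i, ∑ j, (m i j * g i j + C * s⁻¹ * (((1 - ∑ j', A i j' * q j') * p i) *
        ((1 - ∑ i', A i' j * p i') * q j))) := by
        refine Finset.sum_le_sum fun i _ => Finset.sum_le_sum fun j _ => ?_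
        rw [add_mul, add_mul, mul_add]
        refine add_le_add (mul_le_mul_right (hAg1 i j) _) ?_
        calc _ ≤ C * _ := mul_le_mul_left (hm i j) _
          _ = _ := by rw [div_eq_mul_inv]; ring
    _ = ∑ i, ∑ j, m i j * g i j + C * s := by
        simp_rw [Finset.sum_add_distrib, ← Finset.mul_sum, ← Finset.sum_mul]
        rw [hr1, hr2, mul_assoc, ← mul_assoc s⁻¹, ENNReal.inv_mul_cancel hs0 hst, one_mul]
    _ ≤ _ := by gcongr

end RoundMatrix

section Rounding

theorem lintegral_comp_fintype {α I : Type*} [MeasurableSpace α] [Fintype I] [MeasurableSpace I]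
    [MeasurableSingletonClass I] (μ : Measure α) {T : α → I} (hT : Measurable T) (h : I → ℝ≥0∞) :
    ∫⁻ x, h (T x) ∂μ = ∑ i, h i * μ (T ⁻¹' {i}) := by
  rw [← lintegral_map (f := h) .of_discrete hT, lintegral_fintype]
  simp_rw [Measure.map_apply hT (measurableSet_singleton _)]

theorem sum_measure_preimage_singleton_univ {α I : Type*} [MeasurableSpace α] [Fintype I]
    [MeasurableSpace I] [MeasurableSingletonClass I] (μ : Measure α) {T : α → I}
    (hT : Measurable T) : ∑ i, μ (T ⁻¹' {i}) = μ univ := by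
  simpa using (lintegral_comp_fintype μ hT fun _ => 1).symm

variable {E I : Type*} [MeasurableSpace E] [Fintype I] [MeasurableSpace I]
  [MeasurableSingletonClass I] {μ ν : Measure E} {T : E → I}

theorem sum_measure_prod_preimage_left {γ : Measure (E × E)} (hγ : γ ∈ Couplings μ ν)
    (hT : Measurable T) (i : I) :
    ∑ j, γ ((T ⁻¹' {i}) ×ˢ (T ⁻¹' {j})) = μ (T ⁻¹' {i}) := by
  have hi := hT (measurableSet_singleton i)
  have h := sum_measure_preimage_singleton_univ (γ.restrict (Prod.fst ⁻¹' (T ⁻¹' {i})))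
    (hT.comp measurable_snd)
  rw [Measure.restrict_apply_univ, ← Measure.map_apply measurable_fst hi, hγ.2.1] at h
  rw [← h]
  refine Finset.sum_congr rfl fun j _ => ?_
  rw [Measure.restrict_apply ((hT.comp measurable_snd) (measurableSet_singleton j)), inter_comm]
  rfl

theorem sum_measure_prod_preimage_right {γ : Measure (E × E)} (hγ : γ ∈ Couplings μ ν)
    (hT : Measurable T) (j : I) :
    ∑ i, γ ((T ⁻¹' {i}) ×ˢ (T ⁻¹' {j})) = ν (T ⁻¹' {j}) := by
  have hj := hT (measurableSet_singleton j)
  have h := sum_measure_preimage_singleton_univ (γ.restrict (Prod.snd ⁻¹' (T ⁻¹' {j})))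
    (hT.comp measurable_fst)
  rw [Measure.restrict_apply_univ, ← Measure.map_apply measurable_snd hj, hγ.2.2] at h
  rw [← h]
  refine Finset.sum_congr rfl fun i _ => ?_
  rw [Measure.restrict_apply ((hT.comp measurable_fst) (measurableSet_singleton i))]
  rfl

theorem measurable_comp_prodMap (hT : Measurable T) (G : I → I → ℝ≥0∞) :
    Measurable fun z : E × E => G (T z.1) (T z.2) :=
  (Measurable.of_discrete (f := fun w : I × I => G w.1 w.2)).comp
    ((hT.comp measurable_fst).prodMk (hT.comp measurable_snd))

/-- The coupling with step density `G` with respect to the product measure. -/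
def stepPlan (μ ν : Measure E) (T : E → I) (G : I → I → ℝ≥0∞) : Measure (E × E) :=
  (μ.prod ν).withDensity fun z => G (T z.1) (T z.2)

theorem stepPlan_mem_couplings [IsProbabilityMeasure μ] [IsProbabilityMeasure ν]
    (hT : Measurable T) {G : I → I → ℝ≥0∞} (hrow : ∀ i, ∑ j, G i j * ν (T ⁻¹' {j}) = 1)
    (hcol : ∀ j, ∑ i, G i j * μ (T ⁻¹' {i}) = 1) : stepPlan μ ν T G ∈ Couplings μ ν := by
  have hG := measurable_comp_prodMap hT G
  have h₁ : (stepPlan μ ν T G).map Prod.fst = μ := by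
    ext s hs
    rw [Measure.map_apply measurable_fst hs, stepPlan, withDensity_apply _ (measurable_fst hs),
      ← prod_univ, ← Measure.prod_restrict, lintegral_prod _ hG.aemeasurable]
    simp [lintegral_comp_fintype ν hT, hrow]
  have h₂ : (stepPlan μ ν T G).map Prod.snd = ν := by
    ext s hs
    rw [Measure.map_apply measurable_snd hs, stepPlan, withDensity_apply _ (measurable_snd hs),
      ← univ_prod, ← Measure.prod_restrict, lintegral_prod_symm _ hG.aemeasurable]
    have h : ∀ y, ∫⁻ x, G (T x) (T y) ∂μ = 1 := fun y =>
      (lintegral_comp_fintype μ hT fun i => G i (T y)).trans (hcol _)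
    simp [h]
  refine ⟨⟨?_⟩, h₁, h₂⟩
  rw [← preimage_univ (f := Prod.fst), ← Measure.map_apply measurable_fst .univ, h₁, measure_univ]

/-- The step plan given by the rounding of a matrix of rational numbers. -/
def ratPlan (μ ν : Measure E) (T : E → I) (a : I → I → ℚ) : Measure (E × E) :=
  stepPlan μ ν T (roundMatrix (fun i j => ((Real.toNNReal (a i j) : NNReal) : ℝ≥0∞))
    (fun i => μ (T ⁻¹' {i})) fun j => ν (T ⁻¹' {j}))

theorem ratPlan_mem_couplings [IsProbabilityMeasure μ] [IsProbabilityMeasure ν]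
    (hT : Measurable T) (a : I → I → ℚ) : ratPlan μ ν T a ∈ Couplings μ ν :=
  stepPlan_mem_couplings hT
    (sum_roundMatrix_mul _ (by rw [sum_measure_preimage_singleton_univ ν hT, measure_univ]))
    (sum_roundMatrix_mul' _ (by rw [sum_measure_preimage_singleton_univ μ hT, measure_univ]))

theorem ae_fst_snd_mem {γ : Measure (E × E)} (hγ : γ ∈ Couplings μ ν) {X : Set E}
    (hμX : ∀ᵐ x ∂μ, x ∈ X) (hνX : ∀ᵐ x ∂ν, x ∈ X) : ∀ᵐ z ∂γ, z.1 ∈ X ∧ z.2 ∈ X := by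
  refine .and ?_ ?_
  · exact ae_of_ae_map measurable_fst.aemeasurable (hγ.2.1 ▸ hμX)
  · exact ae_of_ae_map measurable_snd.aemeasurable (hγ.2.2 ▸ hνX)

/-- Plans with rational step densities are almost as good as any given coupling, if the cost
oscillates little on the cells of the partition. -/
theorem exists_lintegral_ratPlan_le [IsProbabilityMeasure μ] [IsProbabilityMeasure ν]
    (hT : Measurable T) {X : Set E} {c : E → E → ℝ≥0∞} {C η ε : ℝ≥0∞}
    (hcC : ∀ x ∈ X, ∀ x' ∈ X, c x x' ≤ C)
    (hcη : ∀ x ∈ X, ∀ x' ∈ X, ∀ u ∈ X, ∀ u' ∈ X, T x = T u → T x' = T u' → c x x' ≤ c u u' + η)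
    (hμX : ∀ᵐ x ∂μ, x ∈ X) (hνX : ∀ᵐ x ∂ν, x ∈ X) {γ : Measure (E × E)} (hγ : γ ∈ Couplings μ ν)
    (hε : ε ≠ 0) :
    ∃ a : I → I → ℚ, ∫⁻ z, c z.1 z.2 ∂ratPlan μ ν T a ≤ ∫⁻ z, c z.1 z.2 ∂γ + C * ε + η := by
  set m : I → I → ℝ≥0∞ := fun i j =>
    C ⊓ ⨅ (u ∈ X) (u' ∈ X) (_ : T u = i) (_ : T u' = j), c u u' with hm
  have hmC : ∀ i j, m i j ≤ C := fun i j => inf_le_left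
  have hmc : ∀ x ∈ X, ∀ x' ∈ X, m (T x) (T x') ≤ c x x' := fun x hx x' hx' =>
    inf_le_right.trans (iInf₂_le_of_le x hx (iInf₂_le_of_le x' hx' (iInf₂_le_of_le rfl rfl le_rfl)))
  have hcm : ∀ x ∈ X, ∀ x' ∈ X, c x x' ≤ m (T x) (T x') + η := fun x hx x' hx' => by
    rw [← tsub_le_iff_right]
    refine le_inf (tsub_le_self.trans (hcC x hx x' hx')) ?_
    refine le_iInf₂ fun u hu => le_iInf₂ fun u' hu' => le_iInf₂ fun h h' => ?_
    exact tsub_le_iff_right.2 (hcη x hx x' hx' u hu u' hu' h.symm h'.symm)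
  obtain ⟨a, ha⟩ := exists_rat_roundMatrix_le
    (sum_measure_prod_preimage_left hγ hT) (sum_measure_prod_preimage_right hγ hT)
    (by rw [sum_measure_preimage_singleton_univ μ hT, measure_univ])
    (by rw [sum_measure_preimage_singleton_univ ν hT, measure_univ]) hε
  have hTT : Measurable fun z : E × E => (T z.1, T z.2) :=
    (hT.comp measurable_fst).prodMk (hT.comp measurable_snd)
  have hpre : ∀ i j, (fun z : E × E => (T z.1, T z.2)) ⁻¹' {(i, j)}
      = (T ⁻¹' {i}) ×ˢ (T ⁻¹' {j}) := fun i j => by ext; simp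
  have hR := ratPlan_mem_couplings (μ := μ) (ν := ν) hT a
  have := hR.1
  refine ⟨a, ?_⟩
  calc ∫⁻ z, c z.1 z.2 ∂ratPlan μ ν T a
      ≤ ∫⁻ z, (m (T z.1) (T z.2) + η) ∂ratPlan μ ν T a := by
        refine lintegral_mono_ae ?_
        filter_upwards [ae_fst_snd_mem hR hμX hνX] with z hz using hcm _ hz.1 _ hz.2
    _ = ∫⁻ z, m (T z.1) (T z.2) ∂ratPlan μ ν T a + η := by
        rw [lintegral_add_right _ measurable_const, lintegral_const, measure_univ, mul_one]
    _ ≤ ∫⁻ z, m (T z.1) (T z.2) ∂γ + C * ε + η := by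
        gcongr
        rw [ratPlan, stepPlan, lintegral_withDensity_eq_lintegral_mul _
          (measurable_comp_prodMap hT _) (measurable_comp_prodMap hT _)]
        have h₁ := lintegral_comp_fintype γ hTT fun w => m w.1 w.2
        have h₂ := lintegral_comp_fintype (μ.prod ν) hTT fun w => roundMatrix
          (fun i j => ((Real.toNNReal (a i j) : NNReal) : ℝ≥0∞))
          (fun i => μ (T ⁻¹' {i})) (fun j => ν (T ⁻¹' {j})) w.1 w.2 * m w.1 w.2
        simp only [Fintype.sum_prod_type, hpre, Measure.prod_prod] at h₁ h₂
        simp only [Pi.mul_apply]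
        rw [h₁, h₂]
        refine le_trans (le_of_eq ?_) (ha C m hmC)
        exact Finset.sum_congr rfl fun _ _ => Finset.sum_congr rfl fun _ _ => by ring
    _ ≤ ∫⁻ z, c z.1 z.2 ∂γ + C * ε + η := by
        gcongr ?_ + _ + _
        refine lintegral_mono_ae ?_
        filter_upwards [ae_fst_snd_mem hγ hμX hνX] with z hz using hmc _ hz.1 _ hz.2

theorem measurable_ratPlan {β : Type*} [MeasurableSpace β] (K₁ K₂ : Kernel β E)
    [IsMarkovKernel K₁] [IsMarkovKernel K₂] (hT : Measurable T) (a : I → I → ℚ) :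
    Measurable fun y => ratPlan (K₁ y) (K₂ y) T a := by
  obtain ⟨G, hG₀⟩ : ∃ G : β → I → I → ℝ≥0∞, G = fun y =>
    roundMatrix (fun i j => ((Real.toNNReal (a i j) : NNReal) : ℝ≥0∞))
      (fun i => K₁ y (T ⁻¹' {i})) fun j => K₂ y (T ⁻¹' {j}) := ⟨_, rfl⟩
  have hG₁ : ∀ i j, Measurable fun y => G y i j := fun i j => by
    rw [hG₀]
    exact measurable_roundMatrix _ (fun i => K₁.measurable_coe (hT (measurableSet_singleton i)))
      (fun j => K₂.measurable_coe (hT (measurableSet_singleton j))) i j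
  have hG : Measurable fun w : β × (I × I) => G w.1 w.2.1 w.2.2 :=
    measurable_from_prod_countable_left fun w => hG₁ w.1 w.2
  have hF : Measurable (Function.uncurry fun y (z : E × E) => G y (T z.1) (T z.2)) :=
    hG.comp (measurable_fst.prodMk ((hT.comp (measurable_fst.comp measurable_snd)).prodMk
      (hT.comp (measurable_snd.comp measurable_snd))))
  have h : (fun y => ratPlan (K₁ y) (K₂ y) T a)
      = Kernel.withDensity (K₁ ×ₖ K₂) fun y z => G y (T z.1) (T z.2) := by
    funext y
    rw [Kernel.withDensity_apply _ hF, Kernel.prod_apply, ratPlan, stepPlan, hG₀]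
  rw [h]
  exact Kernel.measurable _

/-- Measurable selection of an almost minimal kernel in a countable family. -/
theorem exists_kernel_lintegral_le_add {α β : Type*} [MeasurableSpace α] [MeasurableSpace β]
    (P : ℕ → Kernel β α) {f : α → ℝ≥0∞} (hf : Measurable f) {ε : ℝ≥0∞} (hε : ε ≠ 0) :
    ∃ Γ : Kernel β α, ∀ y, (∃ n, Γ y = P n y) ∧
      ∀ n, ∫⁻ x, f x ∂Γ y ≤ ∫⁻ x, f x ∂P n y + ε := by
  have hg : ∀ n, Measurable fun y => ∫⁻ x, f x ∂P n y := fun n => hf.lintegral_kernel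
  have hex : ∀ y, ∃ n, ∫⁻ x, f x ∂P n y ≤ (⨅ k, ∫⁻ x, f x ∂P k y) + ε := fun y => by
    by_cases htop : ⨅ k, ∫⁻ x, f x ∂P k y = ⊤
    · exact ⟨0, by simp [htop]⟩
    · obtain ⟨n, hn⟩ := iInf_lt_iff.1 (ENNReal.lt_add_right htop hε)
      exact ⟨n, hn.le⟩
  classical
  have hN : Measurable fun y => Nat.find (hex y) :=
    measurable_find hex fun n => measurableSet_le (hg n) ((Measurable.iInf hg).add_const _)
  have hΓ : Measurable fun y => P (Nat.find (hex y)) y :=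
    (measurable_from_prod_countable_right (f := fun w : ℕ × β => P w.1 w.2)
      fun n => (P n).measurable).comp (hN.prodMk measurable_id)
  refine ⟨⟨_, hΓ⟩, fun y => ⟨⟨_, rfl⟩, fun n => ?_⟩⟩
  exact (Nat.find_spec (hex y)).trans (add_le_add_left (iInf_le _ n) _)

/-- Measurable selection of almost optimal plans between the values of two kernels. -/
theorem exists_kernel_couplings_lintegral_le {β : Type*} [MeasurableSpace β] (K₁ K₂ : Kernel β E)
    [IsMarkovKernel K₁] [IsMarkovKernel K₂] (hT : Measurable T) {X : Set E} {c : E → E → ℝ≥0∞}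
    (hc : Measurable fun z : E × E => c z.1 z.2) {C η ε : ℝ≥0∞}
    (hcC : ∀ x ∈ X, ∀ x' ∈ X, c x x' ≤ C)
    (hcη : ∀ x ∈ X, ∀ x' ∈ X, ∀ u ∈ X, ∀ u' ∈ X, T x = T u → T x' = T u' → c x x' ≤ c u u' + η)
    (hε : ε ≠ 0) :
    ∃ Γ : Kernel β (E × E), (∀ y, Γ y ∈ Couplings (K₁ y) (K₂ y)) ∧
      ∀ y, (∀ᵐ x ∂K₁ y, x ∈ X) → (∀ᵐ x ∂K₂ y, x ∈ X) → ∀ γ ∈ Couplings (K₁ y) (K₂ y),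
        ∫⁻ z, c z.1 z.2 ∂Γ y ≤ ∫⁻ z, c z.1 z.2 ∂γ + C * ε + η + ε := by
  obtain ⟨e, he⟩ := exists_surjective_nat (I → I → ℚ)
  obtain ⟨Γ, hΓ⟩ := exists_kernel_lintegral_le_add
    (fun n => (⟨_, measurable_ratPlan K₁ K₂ hT (e n)⟩ : Kernel β (E × E))) hc hε
  refine ⟨Γ, fun y => ?_, fun y h₁ h₂ γ hγ => ?_⟩
  · obtain ⟨n, hn⟩ := (hΓ y).1
    exact hn ▸ ratPlan_mem_couplings hT (e n)
  · obtain ⟨a, ha⟩ := exists_lintegral_ratPlan_le hT hcC hcη h₁ h₂ hγ hε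
    obtain ⟨n, rfl⟩ := he a
    exact ((hΓ y).2 n).trans (add_le_add_left ha _)

end Rounding

theorem map_swap_mem_couplings {α β : Type*} [MeasurableSpace α] [MeasurableSpace β]
    {μ : Measure α} {ν : Measure β} {γ : Measure (α × β)} (hγ : γ ∈ Couplings μ ν) :
    γ.map Prod.swap ∈ Couplings ν μ := by
  have := hγ.1
  refine ⟨Measure.isProbabilityMeasure_map measurable_swap.aemeasurable, ?_, ?_⟩
  · rw [Measure.map_map measurable_fst measurable_swap]; exact hγ.2.2
  · rw [Measure.map_map measurable_snd measurable_swap]; exact hγ.2.1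

theorem map_compProd_prod_fst {α β γ : Type*} [MeasurableSpace α] [MeasurableSpace β]
    [MeasurableSpace γ] (ν : Measure α) [IsFiniteMeasure ν] (κ : Kernel α β) (κ' : Kernel α γ)
    [IsMarkovKernel κ] [IsMarkovKernel κ'] :
    (ν ⊗ₘ (κ ×ₖ κ')).map (fun w => (w.1, w.2.1)) = ν ⊗ₘ κ := by
  refine Measure.ext_prod fun {s t} hs ht => ?_
  have h : (fun w : α × β × γ => (w.1, w.2.1)) ⁻¹' (s ×ˢ t) = s ×ˢ (t ×ˢ univ) := by
    ext; simp
  rw [Measure.map_apply (by fun_prop) (hs.prod ht), h,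
    Measure.compProd_apply_prod hs (ht.prod .univ), Measure.compProd_apply_prod hs ht]
  simp [Kernel.prod_apply, Measure.prod_prod]

theorem map_compProd_prod_snd {α β γ : Type*} [MeasurableSpace α] [MeasurableSpace β]
    [MeasurableSpace γ] (ν : Measure α) [IsFiniteMeasure ν] (κ : Kernel α β) (κ' : Kernel α γ)
    [IsMarkovKernel κ] [IsMarkovKernel κ'] :
    (ν ⊗ₘ (κ ×ₖ κ')).map (fun w => (w.1, w.2.2)) = ν ⊗ₘ κ' := by
  refine Measure.ext_prod fun {s t} hs ht => ?_
  have h : (fun w : α × β × γ => (w.1, w.2.2)) ⁻¹' (s ×ˢ t) = s ×ˢ (univ ×ˢ t) := by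
    ext; simp
  rw [Measure.map_apply (by fun_prop) (hs.prod ht), h,
    Measure.compProd_apply_prod hs (MeasurableSet.univ.prod ht),
    Measure.compProd_apply_prod hs ht]
  simp [Kernel.prod_apply, Measure.prod_prod]

/-- Gluing of plans along their common marginal. -/
theorem exists_gluing {E : Type*} [MeasurableSpace E] [StandardBorelSpace E] [Nonempty E]
    {μ ν ρ : Measure E}
    {γ₁ γ₂ : Measure (E × E)} (h₁ : γ₁ ∈ Couplings μ ν) (h₂ : γ₂ ∈ Couplings ν ρ) :
    ∃ θ : Measure (E × E × E), θ.map (fun w => (w.2.1, w.1)) = γ₁ ∧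
      θ.map (fun w => (w.1, w.2.2)) = γ₂ := by
  have := h₂.1
  have h₁' := map_swap_mem_couplings h₁
  have := h₁'.1
  have hν : IsProbabilityMeasure ν :=
    h₂.2.1 ▸ Measure.isProbabilityMeasure_map measurable_fst.aemeasurable
  have e₁ : ν ⊗ₘ (γ₁.map Prod.swap).condKernel = γ₁.map Prod.swap := by
    have h := (γ₁.map Prod.swap).disintegrate (γ₁.map Prod.swap).condKernel
    rwa [Measure.fst, h₁'.2.1] at h
  have e₂ : ν ⊗ₘ γ₂.condKernel = γ₂ := by
    have h := γ₂.disintegrate γ₂.condKernel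
    rwa [Measure.fst, h₂.2.1] at h
  refine ⟨ν ⊗ₘ ((γ₁.map Prod.swap).condKernel ×ₖ γ₂.condKernel), ?_, ?_⟩
  · have h := map_compProd_prod_fst ν (γ₁.map Prod.swap).condKernel γ₂.condKernel
    rw [e₁] at h
    have h' := congrArg (Measure.map Prod.swap) h
    rw [Measure.map_map measurable_swap (by fun_prop),
      Measure.map_map measurable_swap measurable_swap, Prod.swap_swap_eq, Measure.map_id] at h'
    exact h'
  · rw [map_compProd_prod_snd, e₂]

theorem W2sq_le {E : Type*} [MetricSpace E] [MeasurableSpace E]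
    {μ ν : Measure E} {γ : Measure (E × E)} (hγ : γ ∈ Couplings μ ν) :
    W2sq μ ν ≤ ∫⁻ z, edist z.1 z.2 ^ 2 ∂γ :=
  iInf₂_le γ hγ

theorem natCast_mul_edist_sq_le {E : Type*} [MetricSpace E] (n : ℕ) (x y z : E) :
    (n : ℝ≥0∞) * edist x z ^ 2 ≤ (n + 1) * edist x y ^ 2 + n * (n + 1) * edist y z ^ 2 := by
  have h : (n : ℝ) * dist x z ^ 2 ≤ (n + 1) * dist x y ^ 2 + n * (n + 1) * dist y z ^ 2 := by
    have h₁ : dist x z ^ 2 ≤ (dist x y + dist y z) ^ 2 :=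
      pow_le_pow_left₀ dist_nonneg (dist_triangle x y z) 2
    have h₂ := mul_le_mul_of_nonneg_left h₁ n.cast_nonneg
    nlinarith [sq_nonneg (dist x y - n * dist y z)]
  simp only [edist_nndist]
  exact_mod_cast h

section Wasserstein

variable {E : Type*} [MetricSpace E] [MeasurableSpace E] [BorelSpace E]
  [SecondCountableTopology E]

theorem exists_finite_partition_dist_lt [Nonempty E] {X : Set E} (hX : IsCompact X) {δ : ℝ}
    (hδ : 0 < δ) : ∃ (N : ℕ) (T : E → Fin (N + 1)), Measurable T ∧
      ∀ x ∈ X, ∀ u ∈ X, T x = T u → dist x u < δ := by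
  set e := TopologicalSpace.denseSeq E
  obtain ⟨t, ht⟩ := hX.elim_finite_subcover (fun k => Metric.ball (e k) (δ / 2))
    (fun _ => Metric.isOpen_ball) fun x _ => by
      obtain ⟨_, hy, k, rfl⟩ := (TopologicalSpace.denseRange_denseSeq E).exists_dist_lt x
        (half_pos hδ) |>.elim fun k hk => (⟨e k, hk, k, rfl⟩ :
          ∃ y, dist x y < δ / 2 ∧ ∃ k, e k = y)
      exact mem_iUnion.2 ⟨k, hy⟩
  have hN : ∀ x ∈ X, dist (SimpleFunc.nearestPt e (t.sup id) x) x < δ / 2 := fun x hx => by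
    obtain ⟨k, hk, hxk⟩ := mem_iUnion₂.1 (ht hx)
    have h := SimpleFunc.edist_nearestPt_le e x (Finset.le_sup (f := id) hk)
    rw [edist_dist, edist_dist, ENNReal.ofReal_le_ofReal_iff dist_nonneg] at h
    exact h.trans_lt (by rwa [dist_comm])
  refine ⟨t.sup id, fun x => ⟨SimpleFunc.nearestPtInd e (t.sup id) x,
    Nat.lt_succ_of_le (SimpleFunc.nearestPtInd_le e _ x)⟩, ?_, fun x hx u hu hxu => ?_⟩
  · refine measurable_to_countable' fun k => ?_
    convert (SimpleFunc.nearestPtInd e (t.sup id)).measurableSet_fiber k using 1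
    ext x
    simp [Fin.ext_iff]
  · have h : SimpleFunc.nearestPt e (t.sup id) x = SimpleFunc.nearestPt e (t.sup id) u :=
      congrArg e (Fin.ext_iff.1 hxu)
    have h₁ := hN x hx
    have h₂ := hN u hu
    rw [h] at h₁
    linarith [dist_triangle_left x u (SimpleFunc.nearestPt e (t.sup id) u)]

theorem measurable_edist_sq : Measurable fun z : E × E => edist z.1 z.2 ^ 2 := by fun_prop

theorem exists_kernel_lintegral_le_W2sq_add [Nonempty E] {β : Type*} [MeasurableSpace β]
    (K₁ K₂ : Kernel β E) [IsMarkovKernel K₁] [IsMarkovKernel K₂] {X : Set E} (hX : IsCompact X)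
    {ε : ℝ≥0∞} (hε : ε ≠ 0) :
    ∃ Γ : Kernel β (E × E), (∀ y, Γ y ∈ Couplings (K₁ y) (K₂ y)) ∧
      ∀ y, (∀ᵐ x ∂K₁ y, x ∈ X) → (∀ᵐ x ∂K₂ y, x ∈ X) →
        ∫⁻ z, edist z.1 z.2 ^ 2 ∂Γ y ≤ W2sq (K₁ y) (K₂ y) + ε := by
  obtain ⟨r, hr₀, hrε⟩ := ENNReal.lt_iff_exists_nnreal_btwn.1 (pos_iff_ne_zero.2 hε)
  have hr : 0 < (r : ℝ) := by exact_mod_cast hr₀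
  obtain ⟨D, hD⟩ := Metric.isBounded_iff.1 hX.isBounded
  have hunif := (hX.prod hX).uniformContinuousOn_of_continuous
    (f := fun z : E × E => dist z.1 z.2 ^ 2) (by fun_prop)
  obtain ⟨δ, hδ, hδX⟩ := Metric.uniformContinuousOn_iff.1 hunif (r / 2) (half_pos hr)
  obtain ⟨N, T, hT, hTX⟩ := exists_finite_partition_dist_lt hX hδ
  have hed : ∀ x x' : E, edist x x' ^ 2 = ENNReal.ofReal (dist x x' ^ 2) := fun x x' => by
    rw [edist_dist, ENNReal.ofReal_pow dist_nonneg]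
  have hs : 0 < (r : ℝ) / 2 / (D ^ 2 + 1) := by positivity
  obtain ⟨Γ, hΓ, hΓc⟩ := exists_kernel_couplings_lintegral_le K₁ K₂ hT (X := X)
    (c := fun x x' => edist x x' ^ 2) measurable_edist_sq (C := ENNReal.ofReal (D ^ 2))
    (η := ENNReal.ofReal (r / 2)) (ε := ENNReal.ofReal (r / 2 / (D ^ 2 + 1)))
    (fun x hx x' hx' => by
      rw [hed]
      exact ENNReal.ofReal_le_ofReal (pow_le_pow_left₀ dist_nonneg (hD hx hx') 2))
    (fun x hx x' hx' u hu u' hu' h h' => by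
      rw [hed, hed, ← ENNReal.ofReal_add (by positivity) (by positivity)]
      refine ENNReal.ofReal_le_ofReal ?_
      have := hδX (x, x') ⟨hx, hx'⟩ (u, u') ⟨hu, hu'⟩
        (max_lt (hTX x hx u hu h) (hTX x' hx' u' hu' h'))
      rw [Real.dist_eq] at this
      linarith [(abs_lt.1 this).2])
    (by simpa using hs)
  refine ⟨Γ, hΓ, fun y h₁ h₂ => ?_⟩
  rw [← tsub_le_iff_right]
  refine le_iInf₂ fun γ hγ => ?_
  rw [tsub_le_iff_right]
  refine (hΓc y h₁ h₂ γ hγ).trans ?_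
  rw [add_assoc, add_assoc]
  gcongr
  rw [← ENNReal.ofReal_mul (by positivity), ← ENNReal.ofReal_add (by positivity) (by positivity),
    ← ENNReal.ofReal_add (by positivity) (by positivity)]
  refine le_trans (le_of_eq ?_) hrε.le
  rw [← ENNReal.ofReal_coe_nnreal]
  congr 1
  field_simp
  ring

theorem aemeasurable_W2sq [Nonempty E] {β : Type*} [MeasurableSpace β] {ν : Measure β}
    (K₁ K₂ : Kernel β E) [IsMarkovKernel K₁] [IsMarkovKernel K₂] {X : Set E} (hX : IsCompact X)
    (h₁ : ∀ᵐ y ∂ν, ∀ᵐ x ∂K₁ y, x ∈ X) (h₂ : ∀ᵐ y ∂ν, ∀ᵐ x ∂K₂ y, x ∈ X) :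
    AEMeasurable (fun y => W2sq (K₁ y) (K₂ y)) ν := by
  choose Γ hΓ hΓc using fun n : ℕ => exists_kernel_lintegral_le_W2sq_add K₁ K₂ hX
    (ε := (n : ℝ≥0∞)⁻¹) (ENNReal.inv_ne_zero.2 (ENNReal.natCast_ne_top n))
  refine ⟨fun y => ⨅ n, ∫⁻ z, edist z.1 z.2 ^ 2 ∂Γ n y,
    .iInf fun n => measurable_edist_sq.lintegral_kernel, ?_⟩
  filter_upwards [h₁, h₂] with y hy₁ hy₂
  refine le_antisymm (le_iInf fun n => W2sq_le (hΓ n y)) ?_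
  refine ENNReal.le_of_forall_pos_le_add fun ε hε _ => ?_
  obtain ⟨n, hn⟩ := ENNReal.exists_inv_nat_lt (ENNReal.coe_ne_zero.2 hε.ne')
  exact (iInf_le _ n).trans ((hΓc n y hy₁ hy₂).trans (by gcongr))

theorem W2sq_comm (μ ν : Measure E) : W2sq μ ν = W2sq ν μ := by
  suffices h : ∀ μ ν : Measure E, W2sq μ ν ≤ W2sq ν μ from le_antisymm (h _ _) (h _ _)
  intro μ ν
  refine le_iInf₂ fun γ hγ => (W2sq_le (map_swap_mem_couplings hγ)).trans_eq ?_
  rw [lintegral_map measurable_edist_sq measurable_swap]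
  simp [edist_comm]

theorem W2sq_self (μ : Measure E) [IsProbabilityMeasure μ] : W2sq μ μ = 0 := by
  have hd : Measurable fun x : E => (x, x) := measurable_id.prodMk measurable_id
  have h : μ.map (fun x => (x, x)) ∈ Couplings μ μ := by
    refine ⟨Measure.isProbabilityMeasure_map hd.aemeasurable, ?_, ?_⟩
    · rw [Measure.map_map measurable_fst hd]; exact Measure.map_id
    · rw [Measure.map_map measurable_snd hd]; exact Measure.map_id
  refine nonpos_iff_eq_zero.1 ((W2sq_le h).trans_eq ?_)
  rw [lintegral_map measurable_edist_sq hd]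
  simp

theorem natCast_mul_W2sq_le [StandardBorelSpace E] [Nonempty E] {n : ℕ} (hn : n ≠ 0)
    (μ ν ρ : Measure E) :
    (n : ℝ≥0∞) * W2sq μ ρ ≤ (n + 1) * W2sq μ ν + n * (n + 1) * W2sq ν ρ := by
  have hn' : (n : ℝ≥0∞) ≠ 0 := by exact_mod_cast hn
  rw [W2sq.eq_def μ ν, W2sq.eq_def ν ρ, transportCost, transportCost, iInf_subtype',
    iInf_subtype', ENNReal.mul_iInf_of_ne (by positivity) (by finiteness),
    ENNReal.mul_iInf_of_ne (by positivity) (by finiteness), ENNReal.iInf_add]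
  refine le_iInf fun ⟨γ₁, h₁⟩ => ?_
  rw [ENNReal.add_iInf]
  refine le_iInf fun ⟨γ₂, h₂⟩ => ?_
  obtain ⟨θ, hθ₁, hθ₂⟩ := exists_gluing h₁ h₂
  have m₁ : Measurable fun w : E × E × E => (w.2.1, w.1) := by fun_prop
  have m₂ : Measurable fun w : E × E × E => (w.1, w.2.2) := by fun_prop
  have hθ : θ.map Prod.snd ∈ Couplings μ ρ := by
    have := h₁.1
    refine ⟨⟨?_⟩, ?_, ?_⟩
    · rw [Measure.map_apply measurable_snd .univ, preimage_univ,
        ← preimage_univ (f := fun w : E × E × E => (w.2.1, w.1)),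
        ← Measure.map_apply m₁ .univ, hθ₁, measure_univ]
    · rw [← h₁.2.1, ← hθ₁, Measure.map_map measurable_fst measurable_snd,
        Measure.map_map measurable_fst m₁]
      rfl
    · rw [← h₂.2.2, ← hθ₂, Measure.map_map measurable_snd measurable_snd,
        Measure.map_map measurable_snd m₂]
      rfl
  calc (n : ℝ≥0∞) * W2sq μ ρ ≤ n * ∫⁻ z, edist z.1 z.2 ^ 2 ∂θ.map Prod.snd := by
        gcongr
        exact W2sq_le hθ
    _ = ∫⁻ w, n * edist w.2.1 w.2.2 ^ 2 ∂θ := by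
        rw [lintegral_map measurable_edist_sq measurable_snd, lintegral_const_mul _ (by fun_prop)]
    _ ≤ ∫⁻ w, ((n + 1) * edist w.2.1 w.1 ^ 2 + n * (n + 1) * edist w.1 w.2.2 ^ 2) ∂θ :=
        lintegral_mono fun w => natCast_mul_edist_sq_le n _ _ _
    _ = (n + 1) * ∫⁻ z, edist z.1 z.2 ^ 2 ∂γ₁ + n * (n + 1) * ∫⁻ z, edist z.1 z.2 ^ 2 ∂γ₂ := by
        rw [lintegral_add_left (by fun_prop), lintegral_const_mul _ (by fun_prop),
          lintegral_const_mul _ (by fun_prop), ← hθ₁, ← hθ₂,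
          lintegral_map measurable_edist_sq m₁, lintegral_map measurable_edist_sq m₂]

end Wasserstein

section Fibered

variable {α β : Type*} [MeasurableSpace α] [MeasurableSpace β] {μ : Measure α} {ν : Measure β}
  {ρ : Measure (α × β)} {K : Kernel β α}

theorem map_swap_eq_compProd_iff_isDisint [IsProbabilityMeasure ν] [IsProbabilityMeasure ρ]
    [IsMarkovKernel K] : ρ.map Prod.swap = ν ⊗ₘ K ↔ IsDisint ν ρ K := by
  refine ⟨fun h => ⟨‹_›, fun s t hs ht => ?_⟩, fun h => Measure.ext_prod fun {t s} ht hs => ?_⟩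
  · rw [← Measure.compProd_apply_prod ht hs, ← h, Measure.map_apply measurable_swap (ht.prod hs),
      preimage_swap_prod]
  · have := Measure.isProbabilityMeasure_map (μ := ρ) measurable_swap.aemeasurable
    rw [Measure.compProd_apply_prod ht hs, ← h.2 s t hs ht,
      Measure.map_apply measurable_swap (ht.prod hs), preimage_swap_prod]

theorem isProbabilityMeasure_of_mem_couplings (hρ : ρ ∈ Couplings μ ν) :
    IsProbabilityMeasure ν := by
  have := hρ.1
  exact hρ.2.2 ▸ Measure.isProbabilityMeasure_map measurable_snd.aemeasurable

theorem exists_isDisint [StandardBorelSpace α] [Nonempty α] (hρ : ρ ∈ Couplings μ ν) :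
    ∃ K, IsDisint ν ρ K := by
  have := hρ.1
  have := isProbabilityMeasure_of_mem_couplings hρ
  have h' := map_swap_mem_couplings hρ
  have := h'.1
  have h := (ρ.map Prod.swap).disintegrate (ρ.map Prod.swap).condKernel
  rw [Measure.fst, h'.2.1] at h
  exact ⟨_, map_swap_eq_compProd_iff_isDisint.1 h.symm⟩

theorem IsDisint.ae_eq [MeasurableSpace.CountableOrCountablyGenerated β α]
    (hρ : ρ ∈ Couplings μ ν) {K' : Kernel β α} (h : IsDisint ν ρ K) (h' : IsDisint ν ρ K') :
    K =ᵐ[ν] K' := by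
  have := hρ.1
  have := isProbabilityMeasure_of_mem_couplings hρ
  have := h.1
  have := h'.1
  refine Kernel.ae_eq_of_compProd_eq ?_
  rw [← map_swap_eq_compProd_iff_isDisint.2 h, map_swap_eq_compProd_iff_isDisint.2 h']

theorem IsDisint.ae_ae_mem (hρ : ρ ∈ Couplings μ ν) (h : IsDisint ν ρ K) {X : Set α}
    (hX : MeasurableSet X) (hμ : ∀ᵐ x ∂μ, x ∈ X) : ∀ᵐ y ∂ν, ∀ᵐ x ∂K y, x ∈ X := by
  have h₀ : ∫⁻ y, K y Xᶜ ∂ν = 0 := by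
    rw [← setLIntegral_univ, ← h.2 _ _ hX.compl .univ, prod_univ,
      ← Measure.map_apply measurable_fst hX.compl, hρ.2.1]
    exact hμ
  filter_upwards [(lintegral_eq_zero_iff (K.measurable_coe hX.compl)).1 h₀] with y hy
  exact hy

theorem WFsq_eq_lintegral [PseudoEMetricSpace α]
    [MeasurableSpace.CountableOrCountablyGenerated β α] {μ₁ μ₂ : Measure α}
    {ρ₁ ρ₂ : Measure (α × β)} (hρ₁ : ρ₁ ∈ Couplings μ₁ ν) (hρ₂ : ρ₂ ∈ Couplings μ₂ ν)
    {K₁ K₂ : Kernel β α} (h₁ : IsDisint ν ρ₁ K₁) (h₂ : IsDisint ν ρ₂ K₂) :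
    WFsq ν ρ₁ ρ₂ = ∫⁻ y, W2sq (K₁ y) (K₂ y) ∂ν := by
  refine le_antisymm (iInf₂_le_of_le K₁ K₂ (iInf₂_le h₁ h₂)) ?_
  refine le_iInf₂ fun K₁' K₂' => le_iInf₂ fun h₁' h₂' => le_of_eq (lintegral_congr_ae ?_)
  filter_upwards [h₁.ae_eq hρ₁ h₁', h₂.ae_eq hρ₂ h₂'] with y hy₁ hy₂
  rw [hy₁, hy₂]

end Fibered

section FiberedWasserstein

variable {E : Type*} [MetricSpace E] [MeasurableSpace E] [BorelSpace E]
  [SecondCountableTopology E] [StandardBorelSpace E] [Nonempty E]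
  {β : Type*} [MeasurableSpace β] {μ : Measure E} {ν : Measure β} {ρ₁ ρ₂ ρ₃ : Measure (E × β)}

theorem WFsq_self (hρ₁ : ρ₁ ∈ Couplings μ ν) : WFsq ν ρ₁ ρ₁ = 0 := by
  obtain ⟨K, hK⟩ := exists_isDisint hρ₁
  have := hK.1
  rw [WFsq_eq_lintegral hρ₁ hρ₁ hK hK]
  simp [W2sq_self]

theorem WFsq_comm (hρ₁ : ρ₁ ∈ Couplings μ ν) (hρ₂ : ρ₂ ∈ Couplings μ ν) :
    WFsq ν ρ₁ ρ₂ = WFsq ν ρ₂ ρ₁ := by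
  obtain ⟨K₁, h₁⟩ := exists_isDisint hρ₁
  obtain ⟨K₂, h₂⟩ := exists_isDisint hρ₂
  rw [WFsq_eq_lintegral hρ₁ hρ₂ h₁ h₂, WFsq_eq_lintegral hρ₂ hρ₁ h₂ h₁]
  simp_rw [W2sq_comm]

theorem natCast_mul_WFsq_le {n : ℕ} (hn : n ≠ 0) {X : Set E} (hX : IsCompact X)
    (hμ : ∀ᵐ x ∂μ, x ∈ X) (hρ₁ : ρ₁ ∈ Couplings μ ν) (hρ₂ : ρ₂ ∈ Couplings μ ν)
    (hρ₃ : ρ₃ ∈ Couplings μ ν) :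
    (n : ℝ≥0∞) * WFsq ν ρ₁ ρ₃ ≤ (n + 1) * WFsq ν ρ₁ ρ₂ + n * (n + 1) * WFsq ν ρ₂ ρ₃ := by
  obtain ⟨K₁, h₁⟩ := exists_isDisint hρ₁
  obtain ⟨K₂, h₂⟩ := exists_isDisint hρ₂
  obtain ⟨K₃, h₃⟩ := exists_isDisint hρ₃
  have := h₁.1
  have := h₂.1
  have := h₃.1
  have hs₁ := h₁.ae_ae_mem hρ₁ hX.measurableSet hμ
  have hs₂ := h₂.ae_ae_mem hρ₂ hX.measurableSet hμ
  have hs₃ := h₃.ae_ae_mem hρ₃ hX.measurableSet hμ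
  have m₁₂ := aemeasurable_W2sq K₁ K₂ hX hs₁ hs₂
  have m₂₃ := aemeasurable_W2sq K₂ K₃ hX hs₂ hs₃
  rw [WFsq_eq_lintegral hρ₁ hρ₃ h₁ h₃, WFsq_eq_lintegral hρ₁ hρ₂ h₁ h₂,
    WFsq_eq_lintegral hρ₂ hρ₃ h₂ h₃, ← lintegral_const_mul'' _ m₁₂, ← lintegral_const_mul'' _ m₂₃,
    ← lintegral_const_mul'' _ (aemeasurable_W2sq K₁ K₃ hX hs₁ hs₃),
    ← lintegral_add_left' (m₁₂.const_mul _)]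
  exact lintegral_mono fun y => natCast_mul_W2sq_le hn _ _ _

theorem WFsq_le_mul_sum {X : Set E} (hX : IsCompact X) (hμ : ∀ᵐ x ∂μ, x ∈ X)
    {ρs : ℕ → Measure (E × β)} (hρs : ∀ n, ρs n ∈ Couplings μ ν) (m n : ℕ) :
    WFsq ν (ρs m) (ρs (m + n)) ≤
      n * ∑ k ∈ Finset.range n, WFsq ν (ρs (m + k)) (ρs (m + k + 1)) := by
  induction n with
  | zero => simp [WFsq_self (hρs m)]
  | succ n ih =>
    rcases eq_or_ne n 0 with rfl | hn
    · simp
    have hn' : (n : ℝ≥0∞) ≠ 0 := by exact_mod_cast hn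
    rw [← ENNReal.mul_le_mul_iff_right hn' (ENNReal.natCast_ne_top n)]
    refine (natCast_mul_WFsq_le hn hX hμ (hρs m) (hρs (m + n)) (hρs (m + n + 1))).trans ?_
    rw [Finset.sum_range_succ, Nat.cast_succ]
    calc _ ≤ (n + 1 : ℝ≥0∞) *
            (n * ∑ k ∈ Finset.range n, WFsq ν (ρs (m + k)) (ρs (m + k + 1))) +
          n * (n + 1) * WFsq ν (ρs (m + n)) (ρs (m + n + 1)) := by gcongr
      _ = _ := by ring

theorem transportCost_le_WFsq {β : Type*} [MeasurableSpace β] [PseudoEMetricSpace β]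
    {ν : Measure β} {ρ₁ ρ₂ : Measure (E × β)} {X : Set E} (hX : IsCompact X)
    (hμ : ∀ᵐ x ∂μ, x ∈ X) (hρ₁ : ρ₁ ∈ Couplings μ ν) (hρ₂ : ρ₂ ∈ Couplings μ ν) :
    transportCost (fun p q => edist p.1 q.1 ^ 2 + edist p.2 q.2 ^ 2) ρ₁ ρ₂ ≤ WFsq ν ρ₁ ρ₂ := by
  obtain ⟨K₁, h₁⟩ := exists_isDisint hρ₁
  obtain ⟨K₂, h₂⟩ := exists_isDisint hρ₂
  have := h₁.1
  have := h₂.1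
  have := hρ₁.1
  have := hρ₂.1
  have := isProbabilityMeasure_of_mem_couplings hρ₁
  rw [WFsq_eq_lintegral hρ₁ hρ₂ h₁ h₂]
  refine ENNReal.le_of_forall_pos_le_add fun ε hε _ => ?_
  obtain ⟨Γ, hΓ, hΓc⟩ := exists_kernel_lintegral_le_W2sq_add K₁ K₂ hX
    (ENNReal.coe_ne_zero.2 hε.ne')
  have : IsMarkovKernel Γ := ⟨fun y => (hΓ y).1⟩
  have hf : Measurable fun w : β × E × E => ((w.2.1, w.1), (w.2.2, w.1)) := by fun_prop
  have hπ : (ν ⊗ₘ Γ).map (fun w => ((w.2.1, w.1), (w.2.2, w.1))) ∈ Couplings ρ₁ ρ₂ := by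
    refine ⟨Measure.isProbabilityMeasure_map hf.aemeasurable, ?_, ?_⟩
    · rw [Measure.map_map measurable_fst hf]
      refine Measure.ext_prod fun {s t} hs ht => ?_
      have hpre : (Prod.fst ∘ fun w : β × E × E => ((w.2.1, w.1), (w.2.2, w.1))) ⁻¹' (s ×ˢ t) =
          t ×ˢ (Prod.fst ⁻¹' s) := by ext; simp [and_comm]
      rw [Measure.map_apply (measurable_fst.comp hf) (hs.prod ht), hpre,
        Measure.compProd_apply_prod ht (measurable_fst hs), h₁.2 s t hs ht]
      simp_rw [← Measure.map_apply measurable_fst hs, (hΓ _).2.1]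
    · rw [Measure.map_map measurable_snd hf]
      refine Measure.ext_prod fun {s t} hs ht => ?_
      have hpre : (Prod.snd ∘ fun w : β × E × E => ((w.2.1, w.1), (w.2.2, w.1))) ⁻¹' (s ×ˢ t) =
          t ×ˢ (Prod.snd ⁻¹' s) := by ext; simp [and_comm]
      rw [Measure.map_apply (measurable_snd.comp hf) (hs.prod ht), hpre,
        Measure.compProd_apply_prod ht (measurable_snd hs), h₂.2 s t hs ht]
      simp_rw [← Measure.map_apply measurable_snd hs, (hΓ _).2.2]
  have hle : ∫⁻ w, (edist w.1.1 w.2.1 ^ 2 + edist w.1.2 w.2.2 ^ 2)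
      ∂(ν ⊗ₘ Γ).map (fun w => ((w.2.1, w.1), (w.2.2, w.1))) ≤
      ∫⁻ y, W2sq (K₁ y) (K₂ y) ∂ν + ε := by
    refine (lintegral_map_le _ _).trans ?_
    simp only [edist_self, ne_eq, OfNat.ofNat_ne_zero, not_false_eq_true, zero_pow, add_zero]
    rw [Measure.lintegral_compProd (by fun_prop)]
    calc _ ≤ ∫⁻ y, (W2sq (K₁ y) (K₂ y) + ε) ∂ν := by
          refine lintegral_mono_ae ?_
          filter_upwards [h₁.ae_ae_mem hρ₁ hX.measurableSet hμ,
            h₂.ae_ae_mem hρ₂ hX.measurableSet hμ] with y hy₁ hy₂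
          exact hΓc y hy₁ hy₂
      _ = _ := by rw [lintegral_add_right _ measurable_const]; simp
  exact (iInf₂_le _ hπ).trans hle

end FiberedWasserstein

/-- Telescoping the energy dissipation inequality. -/
theorem mul_sum_add_le_of_succ_le {a : ℝ≥0∞} {D F : ℕ → ℝ≥0∞}
    (h : ∀ n, a * D n + F (n + 1) ≤ F n) (m n : ℕ) :
    a * ∑ k ∈ Finset.range n, D (m + k) + F (m + n) ≤ F m := by
  induction n with
  | zero => simp
  | succ n ih =>
    rw [Finset.sum_range_succ, mul_add, add_assoc]
    exact (add_le_add_right (h (m + n)) _).trans ih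

/-- for the iterates of the minimizing movement scheme started at `ρ⁰` with
`E(ρ⁰) < ∞`, one has `W(ρ^m, ρ^n) ≤ W_F(ρ^m, ρ^n) ≤ sqrt(2 E(ρ⁰)) · sqrt(τ |m−n|)`, where `W` is
the 2-Wasserstein distance on `X × Y`. -/
theorem stmt13 {d d' : ℕ} (X : Set (Euc d)) (Y : Set (Euc d'))
    (hX : IsCompact X) (hXne : X.Nonempty) (hY : IsCompact Y) (hYne : Y.Nonempty)
    (V : Euc d × Euc d' → ℝ) (hV : ContinuousOn V (X ×ˢ Y)) (hV0 : ∀ p, 0 ≤ V p)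
    (κ : ℝ) (hκ : 0 < κ) (τ : ℝ) (hτ : 0 < τ)
    (ν : Measure (Euc d')) [IsProbabilityMeasure ν] (hνY : ν Yᶜ = 0)
    (μ : Measure (Euc d)) [IsProbabilityMeasure μ] (hμac : μ ≪ volume.restrict X)
    (ρs : ℕ → Measure (Euc d × Euc d'))
    (hρ0Γ : ρs 0 ∈ Couplings μ ν)
    (hρ0E : energyE X ν V κ (ρs 0) < ⊤)
    (hstep : ∀ n : ℕ, ρs (n + 1) ∈ Couplings μ ν ∧
      ∀ σ ∈ Couplings μ ν,
        JKOFun X ν V κ τ (ρs n) (ρs (n + 1)) ≤ JKOFun X ν V κ τ (ρs n) σ) :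
    ∀ m n : ℕ,
      (transportCost prodCostSq (ρs m) (ρs n)) ^ (1/2 : ℝ)
          ≤ (WFsq ν (ρs m) (ρs n)) ^ (1/2 : ℝ)
        ∧ (WFsq ν (ρs m) (ρs n)) ^ (1/2 : ℝ)
          ≤ (2 * energyE X ν V κ (ρs 0)) ^ (1/2 : ℝ)
            * (ENNReal.ofReal τ * (Nat.dist m n : ℝ≥0∞)) ^ (1/2 : ℝ) := by
  have : Nonempty (Euc d) := hXne.to_subtype.map Subtype.val
  have hμX : ∀ᵐ x ∂μ, x ∈ X := hμac.ae_le (ae_restrict_mem hX.measurableSet)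
  have hΓ : ∀ n, ρs n ∈ Couplings μ ν := fun n => n.casesOn hρ0Γ fun n => (hstep n).1
  have hdiss : ∀ n, ENNReal.ofReal (1 / (2 * τ)) * WFsq ν (ρs n) (ρs (n + 1)) +
      energyE X ν V κ (ρs (n + 1)) ≤ energyE X ν V κ (ρs n) := fun n => by
    have h := (hstep n).2 (ρs n) (hΓ n)
    rwa [JKOFun, JKOFun, WFsq_self (hΓ n), mul_zero, zero_add, add_assoc,
      WFsq_comm (hΓ (n + 1)) (hΓ n)] at h
  have hEle : ∀ n, energyE X ν V κ (ρs n) ≤ energyE X ν V κ (ρs 0) := fun n => by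
    simpa using le_of_add_le_right (mul_sum_add_le_of_succ_le hdiss 0 n)
  have hbound : ∀ m n, WFsq ν (ρs m) (ρs (m + n)) ≤
      2 * energyE X ν V κ (ρs 0) * (ENNReal.ofReal τ * n) := fun m n => by
    set S := ∑ k ∈ Finset.range n, WFsq ν (ρs (m + k)) (ρs (m + k + 1))
    have hS : ENNReal.ofReal (1 / (2 * τ)) * S ≤ energyE X ν V κ (ρs 0) :=
      (le_of_add_le_left (mul_sum_add_le_of_succ_le
        (D := fun k => WFsq ν (ρs k) (ρs (k + 1))) hdiss m n)).trans (hEle m)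
    have hτ' : 2 * ENNReal.ofReal τ * ENNReal.ofReal (1 / (2 * τ)) = 1 := by
      rw [← ENNReal.ofReal_ofNat 2, ← ENNReal.ofReal_mul zero_le_two,
        ← ENNReal.ofReal_mul (by positivity), mul_one_div_cancel (by positivity),
        ENNReal.ofReal_one]
    calc WFsq ν (ρs m) (ρs (m + n)) ≤ n * S := WFsq_le_mul_sum hX hμX hΓ m n
      _ = n * (2 * ENNReal.ofReal τ) * (ENNReal.ofReal (1 / (2 * τ)) * S) := by
        rw [mul_assoc, ← mul_assoc _ _ S, hτ', one_mul]
      _ ≤ n * (2 * ENNReal.ofReal τ) * energyE X ν V κ (ρs 0) := by gcongr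
      _ = _ := by ring
  intro m n
  refine ⟨ENNReal.rpow_le_rpow (transportCost_le_WFsq hX hμX (hΓ m) (hΓ n)) (by norm_num), ?_⟩
  rw [← ENNReal.mul_rpow_of_nonneg _ _ (by norm_num)]
  refine ENNReal.rpow_le_rpow ?_ (by norm_num)
  rcases le_total m n with h | h
  · obtain ⟨k, rfl⟩ := Nat.exists_eq_add_of_le h
    simpa [Nat.dist] using hbound m k
  · obtain ⟨k, rfl⟩ := Nat.exists_eq_add_of_le h
    rw [WFsq_comm (hΓ _) (hΓ _)]
    simpa [Nat.dist] using hbound n k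

end
end

section
/- Let X ⊂ ℝ^d be a compact convex set with nonempty interior, Y ⊂ ℝ^{d'} compact, μ a probability measure on X absolutely continuous with respect to Lebesgue measure, V ∈ C²(X×Y), and Π_* ∈ C²(X). Let T_* : X → Y be a Borel map satisfying ∇_X V(x, T_*(x)) = ∇Π_*(x) for all x ∈ X, let ν := (T_*)_♯ μ, and let ρ₀ := (id, T_*)_♯ μ ∈ Γ(μ,ν). Then there exists τ₀ > 0 such that for every τ ∈ (0, τ₀], ρ₀ minimizes the functional ρ ↦ (1/2τ) W_F(ρ, ρ₀)² + ∫_{X×Y} V dρ over Γ(μ,ν); equivalently, for every ρ ∈ Γ(μ,ν), (1/2τ) W_F(ρ, ρ₀)² + ∫ V dρ ≥ ∫ V dρ₀. -/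
open MeasureTheory ProbabilityTheory Filter Set
open scoped ENNReal Topology

noncomputable section

theorem ofReal_integral_le_lintegral_ofReal {α : Type*} [MeasurableSpace α] {μ : Measure α}
    {f : α → ℝ} (hf : Integrable f μ) :
    ENNReal.ofReal (∫ x, f x ∂μ) ≤ ∫⁻ x, ENNReal.ofReal (f x) ∂μ := by
  have h := ofReal_integral_eq_lintegral_ofReal hf.pos_part
    (Eventually.of_forall fun x => le_max_right (f x) 0)
  calc ENNReal.ofReal (∫ x, f x ∂μ) ≤ ENNReal.ofReal (∫ x, max (f x) 0 ∂μ) :=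
        ENNReal.ofReal_le_ofReal
          (integral_mono hf hf.pos_part fun x => le_max_left (f x) 0)
    _ = ∫⁻ x, ENNReal.ofReal (f x) ∂μ := by
        rw [h]
        simp [ENNReal.ofReal_max]

/-- A function whose increments are dominated by a squared distance has its difference of means
dominated by the squared Wasserstein distance. -/
theorem ofReal_integral_sub_le_W2sq {α : Type*} [MeasurableSpace α] [PseudoMetricSpace α]
    {μ ν : Measure α} {f : α → ℝ} (hμ : Integrable f μ) (hν : Integrable f ν)
    {P Q : α → Prop} (hP : ∀ᵐ x ∂μ, P x) (hQ : ∀ᵐ x ∂ν, Q x) {C : ℝ} (hC : 0 < C)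
    (h : ∀ x x', P x → Q x' → f x' - f x ≤ C * dist x x' ^ 2) :
    ENNReal.ofReal ((∫ x, f x ∂ν) - ∫ x, f x ∂μ) ≤ ENNReal.ofReal C * W2sq μ ν := by
  have hC0 : ENNReal.ofReal C ≠ 0 := by simpa using hC
  unfold W2sq transportCost
  simp_rw [ENNReal.mul_iInf_of_ne hC0 ENNReal.ofReal_ne_top]
  refine le_iInf₂ fun γ hγ => ?_
  obtain ⟨-, rfl, rfl⟩ := hγ
  rw [integral_map measurable_fst.aemeasurable hμ.aestronglyMeasurable,
    integral_map measurable_snd.aemeasurable hν.aestronglyMeasurable]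
  have hμ' := hμ.comp_measurable measurable_fst
  have hν' := hν.comp_measurable measurable_snd
  have hP' := ae_of_ae_map measurable_fst.aemeasurable hP
  have hQ' := ae_of_ae_map measurable_snd.aemeasurable hQ
  simp only [Function.comp_def] at hμ' hν'
  rw [← integral_sub hν' hμ', ← lintegral_const_mul' _ _ ENNReal.ofReal_ne_top]
  refine (ofReal_integral_le_lintegral_ofReal (hν'.sub hμ')).trans (lintegral_mono_ae ?_)
  filter_upwards [hP', hQ'] with p hp hq
  rw [edist_dist, ← ENNReal.ofReal_pow dist_nonneg, ← ENNReal.ofReal_mul hC.le]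
  exact ENNReal.ofReal_le_ofReal (h _ _ hp hq)

/-- A disintegration recovers the measure as a swapped composition product. -/
theorem IsDisint.map_swap_eq_compProd {α β : Type*} [MeasurableSpace α] [MeasurableSpace β]
    {ν : Measure β} [SFinite ν] {ρ : Measure (α × β)} [IsFiniteMeasure ρ] {K : Kernel β α}
    (h : IsDisint ν ρ K) : ρ.map Prod.swap = ν ⊗ₘ K := by
  have := h.1
  refine Measure.ext_prod fun {s t} hs ht => ?_
  rw [Measure.map_apply measurable_swap (hs.prod ht), preimage_swap_prod, h.2 t s ht hs,
    Measure.compProd_apply_prod hs ht]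

/-- Fibered version of `ofReal_integral_sub_le_W2sq`. -/
theorem ofReal_integral_sub_le_WFsq {α β : Type*} [MeasurableSpace α] [PseudoMetricSpace α]
    [MeasurableSpace β] {ν : Measure β} [SFinite ν] {ρ₁ ρ₂ : Measure (α × β)}
    [IsFiniteMeasure ρ₁] [IsFiniteMeasure ρ₂] {f : α × β → ℝ}
    (h₁ : Integrable f ρ₁) (h₂ : Integrable f ρ₂)
    {P Q : α × β → Prop} (hP : ∀ᵐ p ∂ρ₁, P p) (hQ : ∀ᵐ p ∂ρ₂, Q p) {C : ℝ} (hC : 0 < C)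
    (h : ∀ x x' y, P (x, y) → Q (x', y) → f (x', y) - f (x, y) ≤ C * dist x x' ^ 2) :
    ENNReal.ofReal ((∫ p, f p ∂ρ₂) - ∫ p, f p ∂ρ₁) ≤ ENNReal.ofReal C * WFsq ν ρ₁ ρ₂ := by
  have hC0 : ENNReal.ofReal C ≠ 0 := by simpa using hC
  unfold WFsq
  simp_rw [ENNReal.mul_iInf_of_ne hC0 ENNReal.ofReal_ne_top]
  refine le_iInf fun K₁ => le_iInf fun K₂ => le_iInf fun hK₁ => le_iInf fun hK₂ => ?_
  have := hK₁.1
  have := hK₂.1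
  have swap : ∀ {ρ : Measure (α × β)} {K : Kernel β α}, ρ.map Prod.swap = ν ⊗ₘ K →
      ρ = (ν ⊗ₘ K).map Prod.swap := fun {ρ K} hρ => by
    rw [← hρ, Measure.map_map measurable_swap measurable_swap]
    simp
  have e₁ := swap hK₁.map_swap_eq_compProd
  have e₂ := swap hK₂.map_swap_eq_compProd
  rw [e₁] at h₁ hP
  rw [e₂] at h₂ hQ
  rw [e₁, e₂, integral_map measurable_swap.aemeasurable h₁.aestronglyMeasurable,
    integral_map measurable_swap.aemeasurable h₂.aestronglyMeasurable]
  replace h₁ := h₁.comp_measurable measurable_swap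
  replace h₂ := h₂.comp_measurable measurable_swap
  have hP' := Measure.ae_ae_of_ae_compProd (ae_of_ae_map measurable_swap.aemeasurable hP)
  have hQ' := Measure.ae_ae_of_ae_compProd (ae_of_ae_map measurable_swap.aemeasurable hQ)
  have i₁ := (Measure.integrable_compProd_iff h₁.aestronglyMeasurable).1 h₁
  have i₂ := (Measure.integrable_compProd_iff h₂.aestronglyMeasurable).1 h₂
  have j₁ := Integrable.integral_compProd h₁
  have j₂ := Integrable.integral_compProd h₂
  simp only [Function.comp_def, Prod.swap_prod_mk, Kernel.prodMkLeft_apply, Kernel.const_apply]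
    at h₁ h₂ hP' hQ' i₁ i₂ j₁ j₂
  rw [Measure.integral_compProd h₁, Measure.integral_compProd h₂]
  simp only [Prod.swap_prod_mk]
  rw [← integral_sub j₂ j₁, ← lintegral_const_mul' _ _ ENNReal.ofReal_ne_top]
  refine (ofReal_integral_le_lintegral_ofReal (j₂.sub j₁)).trans (lintegral_mono_ae ?_)
  filter_upwards [hP', hQ', i₁.1, i₂.1] with y hPy hQy hi₁ hi₂
  exact ofReal_integral_sub_le_W2sq hi₁ hi₂ hPy hQy hC fun x x' hx hx' => h x x' y hx hx'

/-- Quadratic bound around critical points of the slices of a `C²` function, uniform over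
compact sets. -/
theorem exists_sub_le_mul_dist_sq_of_fderiv_eq_zero {E F : Type*}
    [NormedAddCommGroup E] [NormedSpace ℝ E] [NormedAddCommGroup F] [NormedSpace ℝ F]
    [ProperSpace F] {f : E × F → ℝ} (hf : ContDiff ℝ 2 f) {X : Set E} {Y : Set F}
    (hX : IsCompact X) (hXc : Convex ℝ X) (hY : IsCompact Y) :
    ∃ C > (0 : ℝ), ∀ x ∈ X, ∀ x' ∈ X, ∀ y ∈ Y, fderiv ℝ (fun z => f (z, y)) x = 0 →
      f (x, y) - f (x', y) ≤ C * dist x' x ^ 2 := by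
  let D : E × F → E →L[ℝ] ℝ := fun p => (fderiv ℝ f p).comp (ContinuousLinearMap.inl ℝ E F)
  have hD : ContDiff ℝ 1 D :=
    (hf.fderiv_right (m := 1) (by norm_num)).clm_comp contDiff_const
  have hslice : ∀ y z, HasFDerivAt (fun z => f (z, y)) (D (z, y)) z := fun y z =>
    ((hf.differentiable (by norm_num)) (z, y)).hasFDerivAt.comp z (hasFDerivAt_prodMk_left z y)
  obtain ⟨R, hR⟩ := hY.isBounded.subset_closedBall 0
  obtain ⟨M, hM⟩ := (hX.prod (isCompact_closedBall (0 : F) R)).exists_bound_of_continuousOn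
    (hD.continuous_fderiv one_ne_zero).continuousOn
  have hLip : ∀ p ∈ X ×ˢ Metric.closedBall (0 : F) R, ∀ q ∈ X ×ˢ Metric.closedBall (0 : F) R,
      ‖D q - D p‖ ≤ M * ‖q - p‖ := fun p hp q hq =>
    (hXc.prod (convex_closedBall 0 R)).norm_image_sub_le_of_norm_fderiv_le
      (fun x _ => hD.differentiable one_ne_zero x) hM hp hq
  refine ⟨max M 1, by positivity, fun x hx x' hx' y hy h0 => ?_⟩
  rw [(hslice y x).fderiv] at h0
  have hseg : segment ℝ x x' ⊆ X := hXc.segment_subset hx hx'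
  have hbound : ∀ z ∈ segment ℝ x x', ‖D (z, y)‖ ≤ max M 1 * ‖x' - x‖ := fun z hz => by
    have h := hLip (x, y) ⟨hx, hR hy⟩ (z, y) ⟨hseg hz, hR hy⟩
    rw [h0, sub_zero] at h
    have hzx : ‖z - x‖ ≤ ‖x' - x‖ := by
      obtain ⟨t, ht, rfl⟩ := segment_eq_image' ℝ x x' ▸ hz
      simpa [norm_smul, abs_of_nonneg ht.1] using
        mul_le_of_le_one_left (norm_nonneg (x' - x)) ht.2
    calc ‖D (z, y)‖ ≤ M * ‖z - x‖ := by simpa using h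
      _ ≤ max M 1 * ‖x' - x‖ := by gcongr; exact le_max_left _ _
  have h := (convex_segment x x').norm_image_sub_le_of_norm_hasFDerivWithin_le
    (fun z _ => (hslice y z).hasFDerivWithinAt) hbound (left_mem_segment ℝ x x')
    (right_mem_segment ℝ x x')
  rw [dist_eq_norm, pow_two, ← mul_assoc]
  exact (le_abs_self _).trans (by rwa [abs_sub_comm])

/-- stationarity of Monge-type gradient configurations for the unregularized
(`κ = 0`) minimizing movement scheme. If `T_*` satisfies `∇_X V(x, T_*(x)) = ∇Π_*(x)` on `X`,
`ν := (T_*)_♯ μ` and `ρ₀ := (id, T_*)_♯ μ`, then for all sufficiently small `τ > 0`, `ρ₀`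
minimizes `ρ ↦ (1/2τ) W_F(ρ,ρ₀)² + ∫ V dρ` over `Γ(μ,ν)`: for every `ρ ∈ Γ(μ,ν)`,
`∫ V dρ₀ − ∫ V dρ ≤ (1/2τ) W_F(ρ,ρ₀)²`. -/
theorem stmt18 {d d' : ℕ} (X : Set (Euc d)) (Y : Set (Euc d'))
    (hXcompact : IsCompact X) (hXconv : Convex ℝ X) (hXint : (interior X).Nonempty)
    (hY : IsCompact Y) (hYne : Y.Nonempty)
    (μ : Measure (Euc d)) [IsProbabilityMeasure μ]
    (hμX : μ Xᶜ = 0) (hμac : μ ≪ volume)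
    (V : Euc d × Euc d' → ℝ) (hV : ContDiff ℝ 2 V)
    (Pst : Euc d → ℝ) (hPst : ContDiff ℝ 2 Pst)
    (Tst : Euc d → Euc d') (hTmeas : Measurable Tst) (hTXY : MapsTo Tst X Y)
    (hgrad : ∀ x ∈ X, gradient (fun x' => V (x', Tst x)) x = gradient Pst x) :
    ∃ τ₀ > (0 : ℝ), ∀ τ : ℝ, 0 < τ → τ ≤ τ₀ →
      ∀ ρ ∈ Couplings μ (μ.map Tst),
        ENNReal.ofReal
            ((∫ p, V p ∂(μ.map (fun x => (x, Tst x)))) - ∫ p, V p ∂ρ)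
          ≤ ENNReal.ofReal (1 / (2 * τ))
              * WFsq (μ.map Tst) ρ (μ.map (fun x => (x, Tst x))) := by
  have hf : ContDiff ℝ 2 fun p : Euc d × Euc d' => V p - Pst p.1 := hV.sub (hPst.comp contDiff_fst)
  obtain ⟨C, hC, hbound⟩ := exists_sub_le_mul_dist_sq_of_fderiv_eq_zero hf hXcompact hXconv hY
  refine ⟨1 / (2 * C), by positivity, fun τ hτ hτC ρ hρ => ?_⟩
  obtain ⟨hρprob, hρ₁, hρ₂⟩ := hρ
  have hgraph : Measurable fun x => (x, Tst x) := measurable_id.prodMk hTmeas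
  have := Measure.isProbabilityMeasure_map (μ := μ) hTmeas.aemeasurable
  have := Measure.isProbabilityMeasure_map (μ := μ) hgraph.aemeasurable
  have hμX' : ∀ᵐ x ∂μ, x ∈ X := hμX
  have hρXY : ∀ᵐ p ∂ρ, p ∈ X ×ˢ Y := by
    have hY' : ∀ᵐ y ∂μ.map Tst, y ∈ Y :=
      (ae_map_iff hTmeas.aemeasurable hY.measurableSet).2 (hμX'.mono fun x hx => hTXY hx)
    filter_upwards [ae_of_ae_map measurable_fst.aemeasurable (hρ₁ ▸ hμX'),
      ae_of_ae_map measurable_snd.aemeasurable (hρ₂ ▸ hY')] with p h₁ h₂ using ⟨h₁, h₂⟩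
  have hgraphXY : ∀ᵐ p ∂μ.map (fun x => (x, Tst x)), p ∈ X ×ˢ Y ∧ p.2 = Tst p.1 := by
    refine (ae_map_iff hgraph.aemeasurable ?_).2 (hμX'.mono fun x hx => ⟨⟨hx, hTXY hx⟩, rfl⟩)
    exact (hXcompact.prod hY).measurableSet.inter
      (measurableSet_eq_fun measurable_snd (hTmeas.comp measurable_fst))
  have integrable : ∀ (g : Euc d × Euc d' → ℝ) (σ : Measure (Euc d × Euc d'))
      [IsFiniteMeasure σ], Continuous g → (∀ᵐ p ∂σ, p ∈ X ×ˢ Y) → Integrable g σ := by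
    intro g σ _ hg hσ
    obtain ⟨M, hM⟩ := (hXcompact.prod hY).exists_bound_of_continuousOn hg.continuousOn
    exact Integrable.of_bound hg.aestronglyMeasurable M (hσ.mono hM)
  have hgraphXY' := hgraphXY.mono fun p hp => hp.1
  have hP : Continuous fun p : Euc d × Euc d' => Pst p.1 := hPst.continuous.comp continuous_fst
  have hfst : ∀ σ : Measure (Euc d × Euc d'), σ.map Prod.fst = μ →
      ∫ p, Pst p.1 ∂σ = ∫ x, Pst x ∂μ := fun σ hσ => by
    rw [← hσ, integral_map measurable_fst.aemeasurable hPst.continuous.aestronglyMeasurable]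
  have hmap : (μ.map fun x => (x, Tst x)).map Prod.fst = μ := by
    rw [Measure.map_map measurable_fst hgraph]
    exact Measure.map_id
  have key := ofReal_integral_sub_le_WFsq (ν := μ.map Tst)
    (integrable _ ρ hf.continuous hρXY) (integrable _ _ hf.continuous hgraphXY')
    hρXY hgraphXY hC fun x x' y hx hx' => by
      obtain ⟨⟨hx'X, hyY⟩, hy⟩ := hx'
      obtain rfl : y = Tst x' := hy
      refine hbound x' hx'X x hx.1 _ hyY ?_
      have hg := (InnerProductSpace.toDual ℝ (Euc d)).symm.injective (hgrad x' hx'X)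
      have hVd : DifferentiableAt ℝ (fun z => V (z, Tst x')) x' :=
        ((hV.comp (contDiff_prodMk_left (Tst x'))).differentiable (by norm_num)) x'
      rw [fderiv_fun_sub hVd (hPst.differentiable (by norm_num) x'), hg, sub_self]
  rw [integral_sub (integrable _ _ hV.continuous hgraphXY') (integrable _ _ hP hgraphXY'),
    integral_sub (integrable _ _ hV.continuous hρXY) (integrable _ _ hP hρXY),
    hfst _ hmap, hfst _ hρ₁, sub_sub_sub_cancel_right] at key
  refine key.trans (mul_le_mul_left (ENNReal.ofReal_le_ofReal ?_) _)
  rw [le_div_iff₀ (by positivity)] at hτC ⊢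
  linarith

end
end
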